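/- Let f : ℕ and n = 3f+1, let B ⊆ Fin (3f+1) be a finite set with |B| ≤ f, let α be a type of blocks with a round function round : α → ℕ, and let vote : Fin (3f+1) → α → Prop be such that every honest replica votes for at most one block per round (for all i ∉ B and b b' : α, if vote i b, vote i b', and round b = round b', then b = b'). If two blocks b and b' are both certified (each has a finite set of at least 2f+1 replicas all voting for it) and round b = round b', then b = b'. (At most one block is certified in each round.) -/

import Mathlib

/-- At most one block is certified in each round. -/
theorem unique_certified_block_per_round (f : ℕ) (B : Finset (Fin (3 * f + 1)))
    (hB : B.card ≤ f) {α : Type*} (round : α → ℕ)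
    (vote : Fin (3 * f + 1) → α → Prop)
    (honest_once : ∀ i : Fin (3 * f + 1), i ∉ B → ∀ b b' : α,
      vote i b → vote i b' → round b = round b' → b = b')
    (b b' : α)
    (hcert : ∃ Q : Finset (Fin (3 * f + 1)),
      2 * f + 1 ≤ Q.card ∧ ∀ i ∈ Q, vote i b)
    (hcert' : ∃ Q : Finset (Fin (3 * f + 1)),
      2 * f + 1 ≤ Q.card ∧ ∀ i ∈ Q, vote i b')
    (hround : round b = round b') :
    b = b' := by
  obtain ⟨Q, hQ, hvote⟩ := hcert
  obtain ⟨Q', hQ', hvote'⟩ := hcert'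
  obtain ⟨i, hi, hiB⟩ : ∃ i ∈ Q ∩ Q', i ∉ B := by
    refine Finset.exists_mem_notMem_of_card_lt_card (hB.trans_lt ?_)
    have h_union : (Q ∪ Q').card ≤ 3 * f + 1 := by
      simpa using Finset.card_le_univ (Q ∪ Q')
    have h_add := Finset.card_union_add_card_inter Q Q'
    omega
  rw [Finset.mem_inter] at hi
  exact honest_once i hiB b b' (hvote i hi.1) (hvote' i hi.2) hround
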